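/- arXiv:2104.14134 — 3 statements merged into one kernel-verified Lean document; each statement's English description precedes it below -/
import Mathlib

section
/- Suppose a sequence of gains (K_t) is (κ, γ, ρ)-sequentially strongly stable for a system sequence (A_t, B_t), and additionally 1 − γ ≤ ρ < 1. Then for any disturbance sequence (w_t), any initial time t₀, any initial state x_{t₀}, and any t ≥ t₀, the trajectory of the closed-loop system x_{t+1} = (A_t + B_t K_t) x_t + w_t satisfies ‖x_t‖ ≤ κ ρ^{t−t₀} ‖x_{t₀}‖ + (κ/(1−ρ)) · sup_{t₀ ≤ s < t} ‖w_s‖. -/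
open Matrix

/-- Spectral norm (operator 2-norm) of a real matrix. -/
noncomputable def specNorm {m n : Type*} [Fintype m] [Fintype n] [DecidableEq n]
    (M : Matrix m n ℝ) : ℝ :=
  ‖LinearMap.toContinuousLinearMap (Matrix.toEuclideanLin M)‖

/-- Apply a matrix to a Euclidean-space vector. -/
noncomputable def applyMat {m n : Type*} [Fintype m] [Fintype n] [DecidableEq n]
    (M : Matrix m n ℝ) (x : EuclideanSpace ℝ n) : EuclideanSpace ℝ m :=
  Matrix.toEuclideanLin M x

/-- `(κ, γ, ρ)`-sequential strong stability of gains `K` for the system sequence `(A, B)`: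
there are matrices `H_t, L_t` and constants `β₁, β₂ > 0` with `κ = β₁/β₂` such that
`A_t + B_t K_t = H_t L_t H_t⁻¹`, `‖L_t‖ ≤ 1 − γ`, `‖H_t‖ ≤ β₁`, `‖H_t⁻¹‖ ≤ 1/β₂`, and
`‖H_{t+1}⁻¹ H_t‖ ≤ ρ/(1 − γ)`, where `κ > 0`, `0 < γ ≤ 1`, `0 ≤ ρ < 1`. -/
def SeqStronglyStable {d q : Type*} [Fintype d] [Fintype q] [DecidableEq d] [DecidableEq q]
    (A : ℕ → Matrix d d ℝ) (B : ℕ → Matrix d q ℝ) (K : ℕ → Matrix q d ℝ)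
    (κ γ ρ : ℝ) : Prop :=
  0 < κ ∧ 0 < γ ∧ γ ≤ 1 ∧ 0 ≤ ρ ∧ ρ < 1 ∧
  ∃ (H L : ℕ → Matrix d d ℝ) (β₁ β₂ : ℝ), 0 < β₁ ∧ 0 < β₂ ∧ κ = β₁ / β₂ ∧
    ∀ t, IsUnit (H t) ∧
      A t + B t * K t = H t * L t * (H t)⁻¹ ∧
      specNorm (L t) ≤ 1 - γ ∧
      specNorm (H t) ≤ β₁ ∧
      specNorm (H t)⁻¹ ≤ 1 / β₂ ∧
      specNorm ((H (t + 1))⁻¹ * H t) ≤ ρ / (1 - γ)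

theorem norm_applyMat_le {m n : Type*} [Fintype m] [Fintype n] [DecidableEq n]
    (M : Matrix m n ℝ) (x : EuclideanSpace ℝ n) : ‖applyMat M x‖ ≤ specNorm M * ‖x‖ :=
  (LinearMap.toContinuousLinearMap (Matrix.toEuclideanLin M)).le_opNorm x

theorem specNorm_nonneg {m n : Type*} [Fintype m] [Fintype n] [DecidableEq n]
    (M : Matrix m n ℝ) : 0 ≤ specNorm M :=
  norm_nonneg _

theorem applyMat_mul {l m n : Type*} [Fintype l] [Fintype m] [Fintype n] [DecidableEq m]
    [DecidableEq n] (M : Matrix l m ℝ) (N : Matrix m n ℝ) (x : EuclideanSpace ℝ n) :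
    applyMat (M * N) x = applyMat M (applyMat N x) := by
  simp [applyMat, Matrix.toEuclideanLin]

theorem applyMat_add {m n : Type*} [Fintype m] [Fintype n] [DecidableEq n]
    (M : Matrix m n ℝ) (x y : EuclideanSpace ℝ n) :
    applyMat M (x + y) = applyMat M x + applyMat M y :=
  map_add _ x y

theorem applyMat_one {n : Type*} [Fintype n] [DecidableEq n] (x : EuclideanSpace ℝ n) :
    applyMat (1 : Matrix n n ℝ) x = x := by
  simp [applyMat, Matrix.toEuclideanLin]

/-- A real sequence contracting by `ρ < 1` up to an additive error `c` per step stays within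
`c / (1 - ρ)` of geometric decay. -/
theorem le_geometric_add_of_contracting {u : ℕ → ℝ} {ρ c : ℝ} (hρ₀ : 0 ≤ ρ) (hρ : ρ < 1)
    (hc : 0 ≤ c) (n : ℕ) (hu : ∀ k < n, u (k + 1) ≤ ρ * u k + c) :
    u n ≤ ρ ^ n * u 0 + c / (1 - ρ) := by
  have h1 : 0 < 1 - ρ := sub_pos.2 hρ
  induction n with
  | zero => simpa using div_nonneg hc h1.le
  | succ n ih =>
    calc u (n + 1) ≤ ρ * u n + c := hu n n.lt_succ_self
      _ ≤ ρ * (ρ ^ n * u 0 + c / (1 - ρ)) + c := by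
        gcongr
        exact ih fun k hk => hu k (hk.trans n.lt_succ_self)
      _ = ρ ^ (n + 1) * u 0 + c / (1 - ρ) := by field_simp; ring

theorem Finset.le_biSup_real_of_nonneg {ι : Type*} (s : Finset ι) {f : ι → ℝ}
    (hf : ∀ i, 0 ≤ f i) {i : ι} (hi : i ∈ s) : f i ≤ ⨆ j ∈ s, f j := by
  have hb : BddAbove (Set.range fun j => ⨆ _ : j ∈ s, f j) := by
    refine ⟨∑ j ∈ s, f j, ?_⟩
    rintro _ ⟨j, rfl⟩
    exact Real.iSup_le (fun hj => Finset.single_le_sum (fun k _ => hf k) hj)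
      (Finset.sum_nonneg fun k _ => hf k)
  simpa [hi] using le_ciSup hb i

/-- Lemma 4 of the paper: sequential strong stability (with `1 − γ ≤ ρ`)
implies the ISS bound
`‖x_t‖ ≤ κ ρ^{t−t₀} ‖x_{t₀}‖ + (κ/(1−ρ)) · sup_{t₀ ≤ s < t} ‖w_s‖`
for the closed-loop trajectory `x_{t+1} = (A_t + B_t K_t) x_t + w_t`. -/
theorem stmt3 {d p : ℕ}
    (A : ℕ → Matrix (Fin d) (Fin d) ℝ) (B : ℕ → Matrix (Fin d) (Fin p) ℝ)
    (K : ℕ → Matrix (Fin p) (Fin d) ℝ) (κ γ ρ : ℝ)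
    (hsss : SeqStronglyStable A B K κ γ ρ)
    (hγρ : 1 - γ ≤ ρ)
    (t₀ : ℕ) (x w : ℕ → EuclideanSpace ℝ (Fin d))
    (hdyn : ∀ t, t₀ ≤ t → x (t + 1) = applyMat (A t + B t * K t) (x t) + w t) :
    ∀ t, t₀ ≤ t →
      ‖x t‖ ≤ κ * ρ ^ (t - t₀) * ‖x t₀‖
        + κ / (1 - ρ) * ⨆ s ∈ Finset.Ico t₀ t, ‖w s‖ := by
  obtain ⟨-, -, hγ1, hρ₀, hρ, H, L, β₁, β₂, hβ₁, hβ₂, rfl, h⟩ := hsss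
  intro t ht
  set W := ⨆ s ∈ Finset.Ico t₀ t, ‖w s‖
  have hW : 0 ≤ W := Real.iSup_nonneg fun s => Real.iSup_nonneg fun _ => norm_nonneg _
  have hdet : ∀ s, IsUnit (H s).det := fun s => (Matrix.isUnit_iff_isUnit_det _).1 (h s).1
  have hγ0 : 0 ≤ 1 - γ := sub_nonneg.2 hγ1
  have hstep : ∀ s, t₀ ≤ s → s < t → ‖applyMat (H (s + 1))⁻¹ (x (s + 1))‖ ≤
      ρ * ‖applyMat (H s)⁻¹ (x s)‖ + 1 / β₂ * W := by
    intro s hs hst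
    have hcontr : ρ / (1 - γ) * (1 - γ) ≤ ρ := by
      rcases hγ0.eq_or_lt with h0 | h0
      · simpa [← h0] using hρ₀
      · rw [div_mul_cancel₀ _ h0.ne']
    have hws : ‖w s‖ ≤ W := Finset.le_biSup_real_of_nonneg _ (fun i => norm_nonneg (w i))
      (Finset.mem_Ico.2 ⟨hs, hst⟩)
    set z := applyMat (H s)⁻¹ (x s) with hz
    have heq : applyMat (H (s + 1))⁻¹ (x (s + 1)) =
        applyMat ((H (s + 1))⁻¹ * H s) (applyMat (L s) z) + applyMat (H (s + 1))⁻¹ (w s) := by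
      rw [hdyn s hs, (h s).2.1, applyMat_add, hz]
      simp only [applyMat_mul]
    rw [heq]
    obtain ⟨-, -, hL, -, -, hHH⟩ := h s
    obtain ⟨-, -, -, -, hinv, -⟩ := h (s + 1)
    have hq : 0 ≤ ρ / (1 - γ) := div_nonneg hρ₀ hγ0
    refine (norm_add_le _ _).trans (add_le_add ?_ ?_)
    · calc _ ≤ specNorm ((H (s + 1))⁻¹ * H s) * ‖applyMat (L s) z‖ := norm_applyMat_le _ _
        _ ≤ ρ / (1 - γ) * ((1 - γ) * ‖z‖) := by
          gcongr
          exact (norm_applyMat_le _ _).trans (by gcongr)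
        _ ≤ ρ * ‖z‖ := by
          rw [← mul_assoc]
          gcongr
    · exact (norm_applyMat_le _ _).trans (by gcongr)
  obtain ⟨n, rfl⟩ := Nat.exists_eq_add_of_le ht
  have hz := le_geometric_add_of_contracting
    (u := fun k => ‖applyMat (H (t₀ + k))⁻¹ (x (t₀ + k))‖) hρ₀ hρ
    (show 0 ≤ 1 / β₂ * W by positivity) n
    fun k hk => hstep (t₀ + k) (by lia) (by lia)
  have hx : x (t₀ + n) = applyMat (H (t₀ + n)) (applyMat (H (t₀ + n))⁻¹ (x (t₀ + n))) := by
    rw [← applyMat_mul, Matrix.mul_nonsing_inv _ (hdet _), applyMat_one]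
  have h0 : ‖applyMat (H t₀)⁻¹ (x t₀)‖ ≤ 1 / β₂ * ‖x t₀‖ :=
    (norm_applyMat_le _ _).trans (by gcongr; exact (h t₀).2.2.2.2.1)
  rw [Nat.add_sub_cancel_left]
  calc ‖x (t₀ + n)‖
      ≤ specNorm (H (t₀ + n)) * ‖applyMat (H (t₀ + n))⁻¹ (x (t₀ + n))‖ := by
        conv_lhs => rw [hx]
        exact norm_applyMat_le _ _
    _ ≤ β₁ * (ρ ^ n * (1 / β₂ * ‖x t₀‖) + 1 / β₂ * W / (1 - ρ)) := by
        gcongr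
        · exact (h _).2.2.2.1
        · exact hz.trans (by simpa using mul_le_mul_of_nonneg_left h0 (pow_nonneg hρ₀ n))
    _ = β₁ / β₂ * ρ ^ n * ‖x t₀‖ + β₁ / β₂ / (1 - ρ) * W := by ring
end

section
/- Let Q, W ≻ 0 be symmetric d×d matrices, R ≻ 0 a symmetric p×p matrix, α ∈ [0,1), A ∈ ℝ^{d×d} and B ∈ ℝ^{d×p}. Suppose Σ* is a minimizer of the cost c(Σ) = Tr(Q Σ_xx) + Tr(R Σ_uu) over the COCO-LQ feasible set F(A, B, W, α). Then Σ*_{xx} ≻ 0, and setting K = (Σ*_{xu})ᵀ (Σ*_{xx})^{−1} one has Σ*_{uu} = K Σ*_{xx} Kᵀ; equivalently, Σ* = [[Σ*_{xx}, Σ*_{xx} Kᵀ],[K Σ*_{xx}, K Σ*_{xx} Kᵀ]]. -/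
open Matrix

/-- The horizontal concatenation `[A B]`. -/
def ABmat {d q : Type*} (A : Matrix d d ℝ) (B : Matrix d q ℝ) : Matrix d (d ⊕ q) ℝ :=
  Matrix.of fun i => Sum.elim (A i) (B i)

/-- The COCO-LQ feasible set `F(A, B, W, α)`: `Σ ⪰ 0`,
`Σ_xx = [A B] Σ [A B]ᵀ + W`, and `[A B] Σ [A B]ᵀ ⪯ α Σ_xx`. -/
def Feasible {d q : Type*} [Fintype d] [Fintype q] [DecidableEq d] [DecidableEq q]
    (A : Matrix d d ℝ) (B : Matrix d q ℝ) (W : Matrix d d ℝ) (α : ℝ)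
    (S : Matrix (d ⊕ q) (d ⊕ q) ℝ) : Prop :=
  S.PosSemidef ∧
  S.toBlocks₁₁ = ABmat A B * S * (ABmat A B)ᵀ + W ∧
  (α • S.toBlocks₁₁ - ABmat A B * S * (ABmat A B)ᵀ).PosSemidef

/-- The COCO-LQ cost `c(Σ) = Tr(Q Σ_xx) + Tr(R Σ_uu)`. -/
def cost {d q : Type*} [Fintype d] [Fintype q]
    (Q : Matrix d d ℝ) (R : Matrix q q ℝ) (S : Matrix (d ⊕ q) (d ⊕ q) ℝ) : ℝ :=
  (Q * S.toBlocks₁₁).trace + (R * S.toBlocks₂₂).trace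

open scoped MatrixOrder

section Auxiliary

variable {m n : Type*} [Fintype m] [Fintype n]

theorem posSemidef_mul_mul_transpose {D : Matrix n n ℝ} (hD : D.PosSemidef) (L : Matrix m n ℝ) :
    (L * D * Lᵀ).PosSemidef := by
  simpa [conjTranspose_eq_transpose_of_trivial] using hD.mul_mul_conjTranspose_same L

theorem trace_mul_nonneg_of_posSemidef {Q D : Matrix n n ℝ} (hQ : Q.PosSemidef)
    (hD : D.PosSemidef) : 0 ≤ (Q * D).trace := by
  classical
  obtain ⟨Y, rfl⟩ := CStarAlgebra.nonneg_iff_eq_star_mul_self.mp hQ.nonneg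
  rw [mul_assoc, trace_mul_comm, star_eq_conjTranspose]
  exact (hD.mul_mul_conjTranspose_same Y).trace_nonneg

theorem eq_zero_of_trace_mul_eq_zero {R V : Matrix n n ℝ} (hR : R.PosDef)
    (hV : V.PosSemidef) (h : (R * V).trace = 0) : V = 0 := by
  classical
  obtain ⟨Y, hY, rfl⟩ := CStarAlgebra.isStrictlyPositive_iff_eq_star_mul_self.mp
    hR.isStrictlyPositive
  rw [mul_assoc, trace_mul_comm, star_eq_conjTranspose,
    (hV.mul_mul_conjTranspose_same Y).trace_eq_zero_iff, ← star_eq_conjTranspose] at h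
  lift Y to (Matrix n n ℝ)ˣ using hY
  have h1 : (Y : Matrix n n ℝ) * V = 0 := (Units.isUnit Y).star.mul_left_eq_zero.mp h
  exact (Units.isUnit Y).mul_right_eq_zero.mp h1

/-- A symmetric matrix is bounded below by a negative multiple of any positive definite one. -/
theorem exists_add_smul_posSemidef {X D : Matrix n n ℝ} (hX : X.PosDef) (hD : D.IsHermitian) :
    ∃ c : ℝ, (D + c • X).PosSemidef := by
  classical
  obtain ⟨Y, hY, rfl⟩ := CStarAlgebra.isStrictlyPositive_iff_eq_star_mul_self.mp
    hX.isStrictlyPositive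
  lift Y to (Matrix n n ℝ)ˣ using hY
  let Z : Matrix n n ℝ := ((Y⁻¹ : (Matrix n n ℝ)ˣ) : Matrix n n ℝ)
  have hZY : Z * (Y : Matrix n n ℝ) = 1 := Y.inv_mul
  have hE : (Zᴴ * D * Z).IsHermitian := isHermitian_conjTranspose_mul_mul Z hD
  refine ⟨∑ i, |hE.eigenvalues i|, ?_⟩
  set c : ℝ := ∑ i, |hE.eigenvalues i| with hc
  have key : (Zᴴ * D * Z + c • (1 : Matrix n n ℝ)).PosSemidef := by
    let U : Matrix n n ℝ := hE.eigenvectorUnitary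
    have hU : U * Uᴴ = 1 := Unitary.coe_mul_star_self hE.eigenvectorUnitary
    have hs : Zᴴ * D * Z = U * diagonal hE.eigenvalues * Uᴴ := by
      conv_lhs => rw [hE.spectral_theorem]
      rfl
    have h1 : U * diagonal hE.eigenvalues * Uᴴ + c • (1 : Matrix n n ℝ)
        = U * (diagonal hE.eigenvalues + c • (1 : Matrix n n ℝ)) * Uᴴ := by
      rw [mul_add, add_mul, Matrix.mul_smul, Matrix.smul_mul, mul_one, hU]
    rw [hs, h1, smul_one_eq_diagonal, diagonal_add]
    refine PosSemidef.mul_mul_conjTranspose_same (PosSemidef.diagonal fun i => ?_) U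
    have h2 : |hE.eigenvalues i| ≤ c :=
      Finset.single_le_sum (f := fun i => |hE.eigenvalues i|)
        (fun _ _ => abs_nonneg _) (Finset.mem_univ i)
    have h3 := neg_abs_le (hE.eigenvalues i)
    simp only [Pi.zero_apply]
    linarith
  have h4 := key.conjTranspose_mul_mul_same (Y : Matrix n n ℝ)
  have h5 : (Y : Matrix n n ℝ)ᴴ * Zᴴ = 1 := by
    rw [← conjTranspose_mul, hZY, conjTranspose_one]
  have h6 : (Y : Matrix n n ℝ)ᴴ * (Zᴴ * D * Z + c • (1 : Matrix n n ℝ)) * (Y : Matrix n n ℝ)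
      = D + c • (star (Y : Matrix n n ℝ) * (Y : Matrix n n ℝ)) := by
    calc _ = ((Y : Matrix n n ℝ)ᴴ * Zᴴ) * D * (Z * (Y : Matrix n n ℝ))
          + c • (star (Y : Matrix n n ℝ) * (Y : Matrix n n ℝ)) := by
          simp only [mul_add, add_mul, Matrix.mul_smul, Matrix.smul_mul, mul_one, mul_assoc,
            star_eq_conjTranspose]
      _ = _ := by rw [h5, hZY, one_mul, mul_one]
  rwa [h6] at h4

/-- Comparison principle for the discrete Lyapunov operator `D ↦ D - L D Lᵀ` of a contraction. -/
theorem posSemidef_of_sub_mul_mul_transpose {X L D : Matrix n n ℝ} {α : ℝ} (hα0 : 0 ≤ α)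
    (hα1 : α < 1) (hX : X.PosDef) (hL : (α • X - L * X * Lᵀ).PosSemidef) (hD : D.IsHermitian)
    (h : (D - L * D * Lᵀ).PosSemidef) : D.PosSemidef := by
  obtain ⟨c, hc⟩ := exists_add_smul_posSemidef hX hD
  have hc' : (D + |c| • X).PosSemidef := by
    have := hc.add (hX.posSemidef.smul (sub_nonneg.mpr (le_abs_self c)))
    rwa [sub_smul, add_add_sub_cancel] at this
  have key : ∀ k : ℕ, (D + (|c| * α ^ k) • X).PosSemidef := by
    intro k
    induction k with
    | zero => simpa using hc'
    | succ k ih =>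
      have h1 := (posSemidef_mul_mul_transpose ih L).add
        (h.add (hL.smul (show 0 ≤ |c| * α ^ k by positivity)))
      have h2 : L * (D + (|c| * α ^ k) • X) * Lᵀ
          + (D - L * D * Lᵀ + (|c| * α ^ k) • (α • X - L * X * Lᵀ))
          = D + (|c| * α ^ (k + 1)) • X := by
        rw [mul_add, add_mul, Matrix.mul_smul, Matrix.smul_mul, smul_sub, smul_smul, pow_succ,
          mul_assoc |c|]
        abel
      rwa [h2] at h1
  refine PosSemidef.of_dotProduct_mulVec_nonneg hD fun x => ?_
  have ht : Filter.Tendsto (fun k : ℕ => star x ⬝ᵥ (D *ᵥ x) + |c| * α ^ k * (star x ⬝ᵥ (X *ᵥ x)))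
      Filter.atTop (nhds (star x ⬝ᵥ (D *ᵥ x) + |c| * 0 * (star x ⬝ᵥ (X *ᵥ x)))) :=
    (((tendsto_pow_atTop_nhds_zero_of_lt_one hα0 hα1).const_mul _).mul_const _).const_add _
  rw [mul_zero, zero_mul, add_zero] at ht
  refine ge_of_tendsto' ht fun k => ?_
  have := (key k).dotProduct_mulVec_nonneg x
  rwa [add_mulVec, smul_mulVec, dotProduct_add, dotProduct_smul, smul_eq_mul] at this

/-- Solvability of the discrete Lyapunov equation `D - L D Lᵀ = G` for a contraction. -/
theorem exists_posSemidef_lyapunov {X L G : Matrix n n ℝ} {α : ℝ} (hα0 : 0 ≤ α)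
    (hα1 : α < 1) (hX : X.PosDef) (hL : (α • X - L * X * Lᵀ).PosSemidef) (hG : G.PosSemidef) :
    ∃ D : Matrix n n ℝ, D.PosSemidef ∧ D = L * D * Lᵀ + G := by
  let H := selfAdjoint.submodule ℝ (Matrix n n ℝ)
  have hmem : ∀ D ∈ H, D - L * D * Lᵀ ∈ H := by
    intro D hD
    have hD' : D.IsHermitian := hD
    have h1 : (L * D * Lᵀ).IsHermitian := by
      simpa [conjTranspose_eq_transpose_of_trivial] using isHermitian_mul_mul_conjTranspose L hD'
    exact hD'.sub h1
  let T : H →ₗ[ℝ] H :=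
    { toFun := fun D => ⟨D - L * D * Lᵀ, hmem D D.2⟩
      map_add' := fun D E => by
        ext1
        simp only [Submodule.coe_add, mul_add, add_mul]
        abel
      map_smul' := fun a D => by
        ext1
        simp [mul_assoc, smul_sub] }
  have hinj : Function.Injective T := by
    refine (injective_iff_map_eq_zero T).mpr fun D hD => ?_
    have h0 : (D : Matrix n n ℝ) - L * D * Lᵀ = 0 := congrArg Subtype.val hD
    have hp := posSemidef_of_sub_mul_mul_transpose hα0 hα1 hX hL D.2 (h0 ▸ PosSemidef.zero)
    have hn : (-(D : Matrix n n ℝ)).PosSemidef := by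
      refine posSemidef_of_sub_mul_mul_transpose hα0 hα1 hX hL (IsHermitian.neg D.2) ?_
      have h1 : -(D : Matrix n n ℝ) - L * -D * Lᵀ = -((D : Matrix n n ℝ) - L * D * Lᵀ) := by
        rw [mul_neg, neg_mul]
        abel
      rw [h1, h0, neg_zero]
      exact PosSemidef.zero
    exact Subtype.ext (le_antisymm (neg_nonneg.mp hn.nonneg) hp.nonneg)
  obtain ⟨D, hD⟩ := (LinearMap.injective_iff_surjective.mp hinj) ⟨G, hG.isHermitian⟩
  have h0 : (D : Matrix n n ℝ) - L * D * Lᵀ = G := congrArg Subtype.val hD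
  exact ⟨D, posSemidef_of_sub_mul_mul_transpose hα0 hα1 hX hL D.2 (h0 ▸ hG),
    (sub_eq_iff_eq_add'.mp h0)⟩

end Auxiliary

theorem ABmat_eq_fromCols {d q : Type*} (A : Matrix d d ℝ) (B : Matrix d q ℝ) :
    ABmat A B = fromCols A B := by
  ext i (j | j) <;> rfl

/-- The covariance of `(x, K x + v)` with `x` of covariance `X` and `v` independent of
covariance `V`, pushed forward by `[A B]`. -/
theorem ABmat_mul_fromBlocks_mul {d q : Type*} [Fintype d] [Fintype q]
    (A X : Matrix d d ℝ) (B : Matrix d q ℝ) (K : Matrix q d ℝ) (V : Matrix q q ℝ) :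
    ABmat A B * fromBlocks X (X * Kᵀ) (K * X) (K * X * Kᵀ + V) * (ABmat A B)ᵀ
      = (A + B * K) * X * (A + B * K)ᵀ + B * V * Bᵀ := by
  rw [ABmat_eq_fromCols, fromCols_mul_fromBlocks, transpose_fromCols, fromCols_mul_fromRows]
  simp only [transpose_add, transpose_mul, mul_add, add_mul, Matrix.mul_assoc]
  simp only [Matrix.mul_add, Matrix.add_mul, Matrix.mul_assoc]
  abel

theorem posSemidef_fromBlocks_mul_transpose {d q : Type*} [Fintype d] [Fintype q]
    {X : Matrix d d ℝ} (hX : X.PosSemidef) (K : Matrix q d ℝ) :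
    (fromBlocks X (X * Kᵀ) (K * X) (K * X * Kᵀ)).PosSemidef := by
  classical
  have h := posSemidef_mul_mul_transpose hX (fromRows (1 : Matrix d d ℝ) K)
  rwa [transpose_fromRows, fromRows_mul, fromRows_mul_fromCols, transpose_one, Matrix.one_mul,
    Matrix.mul_one, Matrix.mul_one] at h

/-- Lemma 5 of the paper: a minimizer `Σ*` of the COCO-LQ cost over
`F(A, B, W, α)` has `Σ*_xx ≻ 0` and, with `K = (Σ*_xu)ᵀ (Σ*_xx)⁻¹`, is of the low-rank
form `Σ* = [[Σ*_xx, Σ*_xx Kᵀ],[K Σ*_xx, K Σ*_xx Kᵀ]]`. -/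
theorem stmt5 {d p : ℕ}
    (Q W : Matrix (Fin d) (Fin d) ℝ) (R : Matrix (Fin p) (Fin p) ℝ)
    (hQ : Q.PosDef) (hW : W.PosDef) (hR : R.PosDef)
    (α : ℝ) (hα0 : 0 ≤ α) (hα1 : α < 1)
    (A : Matrix (Fin d) (Fin d) ℝ) (B : Matrix (Fin d) (Fin p) ℝ)
    (S : Matrix (Fin d ⊕ Fin p) (Fin d ⊕ Fin p) ℝ)
    (hfeas : Feasible A B W α S)
    (hmin : ∀ S', Feasible A B W α S' → cost Q R S ≤ cost Q R S') :
    S.toBlocks₁₁.PosDef ∧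
    S.toBlocks₂₂ =
      (S.toBlocks₁₂ᵀ * S.toBlocks₁₁⁻¹) * S.toBlocks₁₁ * (S.toBlocks₁₂ᵀ * S.toBlocks₁₁⁻¹)ᵀ ∧
    S = Matrix.fromBlocks
      S.toBlocks₁₁
      (S.toBlocks₁₁ * (S.toBlocks₁₂ᵀ * S.toBlocks₁₁⁻¹)ᵀ)
      ((S.toBlocks₁₂ᵀ * S.toBlocks₁₁⁻¹) * S.toBlocks₁₁)
      ((S.toBlocks₁₂ᵀ * S.toBlocks₁₁⁻¹) * S.toBlocks₁₁ * (S.toBlocks₁₂ᵀ * S.toBlocks₁₁⁻¹)ᵀ) := by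
  obtain ⟨hS, hfix, hcon⟩ := hfeas
  set X := S.toBlocks₁₁ with hXdef
  set N := S.toBlocks₁₂ with hNdef
  set U := S.toBlocks₂₂ with hUdef
  have hX : X.PosDef := by
    rw [hfix]
    exact hW.posSemidef_add (posSemidef_mul_mul_transpose hS _)
  have hXT : Xᵀ = X := by
    simpa [conjTranspose_eq_transpose_of_trivial] using hX.isHermitian.eq
  have hN : S.toBlocks₂₁ = Nᵀ := by
    ext i j
    exact (hS.isHermitian.apply (Sum.inr i) (Sum.inl j)).symm
  have hSb : S = fromBlocks X N Nᵀ U := by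
    rw [← hN, hXdef, hNdef, hUdef, fromBlocks_toBlocks]
  have hdet : IsUnit X.det := (isUnit_iff_isUnit_det X).mp hX.isUnit
  set K := Nᵀ * X⁻¹ with hK
  have hKX : K * X = Nᵀ := nonsing_inv_mul_cancel_right _ _ hdet
  have hXK : X * Kᵀ = N := by
    have := congrArg transpose hKX
    rwa [transpose_mul, hXT, transpose_transpose] at this
  let V := U - K * X * Kᵀ
  have hV : V.PosSemidef := by
    have : Invertible X := X.invertibleOfIsUnitDet hdet
    have h1 := hS
    rw [hSb, ← conjTranspose_eq_transpose_of_trivial, PosDef.fromBlocks₁₁ N U hX,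
      conjTranspose_eq_transpose_of_trivial, ← hK] at h1
    rwa [← hXK, ← Matrix.mul_assoc] at h1
  have hUV : U = K * X * Kᵀ + V := (add_sub_cancel _ _).symm
  have hSK : S = fromBlocks X (X * Kᵀ) (K * X) (K * X * Kᵀ + V) := by
    rw [← hUV, hXK, hKX]
    exact hSb
  set L := A + B * K with hLdef
  have hM : ABmat A B * S * (ABmat A B)ᵀ = L * X * Lᵀ + B * V * Bᵀ := by
    conv_lhs => rw [hSK]
    exact ABmat_mul_fromBlocks_mul A X B K V
  rw [hM] at hfix hcon
  have hG := posSemidef_mul_mul_transpose hV B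
  have hL : (α • X - L * X * Lᵀ).PosSemidef := by
    have := hcon.add hG
    rwa [← sub_sub, sub_add_cancel] at this
  obtain ⟨D, hD, hDeq⟩ := exists_posSemidef_lyapunov hα0 hα1 hX hL hG
  have hLsub : L * (X - D) * Lᵀ = L * X * Lᵀ - L * D * Lᵀ := by
    rw [mul_sub, sub_mul]
  have hX'eq : X - D = L * (X - D) * Lᵀ + W := by
    rw [hLsub]
    calc X - D = (L * X * Lᵀ + B * V * Bᵀ + W) - (L * D * Lᵀ + B * V * Bᵀ) :=
          congrArg₂ (· - ·) hfix hDeq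
      _ = L * X * Lᵀ - L * D * Lᵀ + W := by abel
  have hX' : (X - D).PosSemidef := by
    refine posSemidef_of_sub_mul_mul_transpose hα0 hα1 hX hL
      (hX.isHermitian.sub hD.isHermitian) ?_
    rw [sub_eq_iff_eq_add'.mpr hX'eq]
    exact hW.posSemidef
  let S' := fromBlocks (X - D) ((X - D) * Kᵀ) (K * (X - D)) (K * (X - D) * Kᵀ)
  have hM' : ABmat A B * S' * (ABmat A B)ᵀ = L * (X - D) * Lᵀ := by
    have h := ABmat_mul_fromBlocks_mul A (X - D) B K 0
    rwa [add_zero, Matrix.mul_zero, Matrix.zero_mul, add_zero] at h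
  have hfeas' : Feasible A B W α S' := by
    refine ⟨posSemidef_fromBlocks_mul_transpose hX' K, ?_, ?_⟩
    · rw [hM', toBlocks_fromBlocks₁₁]
      exact hX'eq
    · rw [hM', toBlocks_fromBlocks₁₁, hLsub]
      have h1 := hcon.add (hD.smul (sub_nonneg.mpr hα1.le))
      have h2 : α • X - (L * X * Lᵀ + B * V * Bᵀ) + (1 - α) • D
          = α • (X - D) - (L * X * Lᵀ - L * D * Lᵀ) := by
        rw [sub_smul, one_smul, smul_sub, ← sub_eq_iff_eq_add'.mpr hDeq]
        abel
      rwa [h2] at h1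
  have hcost := hmin S' hfeas'
  have hVtr : (R * V).trace = 0 := by
    refine le_antisymm ?_ (trace_mul_nonneg_of_posSemidef hR.posSemidef hV)
    have h1 := trace_mul_nonneg_of_posSemidef hQ.posSemidef hD
    have h2 := trace_mul_nonneg_of_posSemidef hR.posSemidef (posSemidef_mul_mul_transpose hD K)
    simp only [cost, S', toBlocks_fromBlocks₁₁, toBlocks_fromBlocks₂₂] at hcost
    rw [← hXdef, ← hUdef, hUV] at hcost
    simp only [Matrix.mul_sub, Matrix.sub_mul, Matrix.mul_add, trace_sub, trace_add] at hcost
    linarith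
  have hV0 : V = 0 := eq_zero_of_trace_mul_eq_zero hR hV hVtr
  rw [hV0, add_zero] at hUV hSK
  exact ⟨hX, hUV, hSK⟩
end

section
/- Let R ∈ ℝ^{p×p} be symmetric positive definite with condition number κ_R = ‖R‖‖R^{−1}‖, let B ∈ ℝ^{d×p} satisfy B Bᵀ ⪰ σ² I for some σ > 0 and ‖B‖ ≤ β, and let A, M ∈ ℝ^{d×d} with ‖A‖ ≤ a₀ and ‖M‖ ≤ m. Then B R^{−1} Bᵀ is invertible, and the matrix K₀ := R^{−1} Bᵀ (B R^{−1} Bᵀ)^{−1} (M − A) satisfies: (i) A + B K₀ = M; (ii) for every symmetric Σ ≻ 0 (d×d), K₀ is the unique minimizer of K ↦ Tr(R K Σ Kᵀ) over the affine set {K ∈ ℝ^{p×d} : A + B K = M}; and (iii) ‖K₀‖ ≤ κ_R (β/σ²)(m + a₀). -/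
open Matrix

open scoped Matrix.Norms.L2Operator MatrixOrder in
theorem Matrix.PosDef.exists_isUnit_transpose_mul_self {n : ℕ}
    {R : Matrix (Fin n) (Fin n) ℝ} (hR : R.PosDef) :
    ∃ C : Matrix (Fin n) (Fin n) ℝ, IsUnit C ∧ R = Cᵀ * C := by
  obtain ⟨C, hC, h⟩ := CStarAlgebra.isStrictlyPositive_iff_eq_star_mul_self.mp
    hR.isStrictlyPositive
  exact ⟨C, hC, by rw [h, star_eq_conjTranspose, conjTranspose_eq_transpose_of_trivial]⟩

section SpectralNorm

variable {l m n : ℕ}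

theorem specNorm_nonneg_s13 (A : Matrix (Fin m) (Fin n) ℝ) : 0 ≤ specNorm A := norm_nonneg _

open scoped Matrix.Norms.L2Operator in
theorem specNorm_mul_le (A : Matrix (Fin l) (Fin m) ℝ) (B : Matrix (Fin m) (Fin n) ℝ) :
    specNorm (A * B) ≤ specNorm A * specNorm B :=
  l2_opNorm_mul A B

open scoped Matrix.Norms.L2Operator in
theorem specNorm_transpose (A : Matrix (Fin m) (Fin n) ℝ) : specNorm Aᵀ = specNorm A := by
  rw [← conjTranspose_eq_transpose_of_trivial]
  exact l2_opNorm_conjTranspose A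

open scoped Matrix.Norms.L2Operator in
theorem specNorm_transpose_mul_self (A : Matrix (Fin m) (Fin n) ℝ) :
    specNorm (Aᵀ * A) = specNorm A * specNorm A := by
  rw [← conjTranspose_eq_transpose_of_trivial]
  exact l2_opNorm_conjTranspose_mul_self A

open scoped Matrix.Norms.L2Operator in
theorem specNorm_sub_le (A B : Matrix (Fin m) (Fin n) ℝ) :
    specNorm (A - B) ≤ specNorm A + specNorm B :=
  norm_sub_le A B

theorem norm_toLp_mulVec_le (A : Matrix (Fin m) (Fin n) ℝ) (x : Fin n → ℝ) :
    ‖WithLp.toLp 2 (A *ᵥ x)‖ ≤ specNorm A * ‖WithLp.toLp 2 x‖ :=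
  (LinearMap.toContinuousLinearMap (Matrix.toEuclideanLin A)).le_opNorm (WithLp.toLp 2 x)

theorem specNorm_le_of_mulVec_le (A : Matrix (Fin m) (Fin n) ℝ) {c : ℝ} (hc : 0 ≤ c)
    (h : ∀ x : Fin n → ℝ, ‖WithLp.toLp 2 (A *ᵥ x)‖ ≤ c * ‖WithLp.toLp 2 x‖) :
    specNorm A ≤ c :=
  ContinuousLinearMap.opNorm_le_bound _ hc fun x => h x.ofLp

theorem dotProduct_self_eq_norm_sq (x : Fin n → ℝ) : x ⬝ᵥ x = ‖WithLp.toLp 2 x‖ ^ 2 := by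
  rw [EuclideanSpace.real_norm_sq_eq]
  simp [dotProduct, sq]

theorem dotProduct_le_norm_mul_norm (x y : Fin n → ℝ) :
    x ⬝ᵥ y ≤ ‖WithLp.toLp 2 x‖ * ‖WithLp.toLp 2 y‖ := by
  have h := real_inner_le_norm (WithLp.toLp 2 y) (WithLp.toLp 2 x)
  rw [EuclideanSpace.inner_toLp_toLp, star_trivial] at h
  linarith

theorem norm_mulVec_sq_le_of_posDef {R : Matrix (Fin n) (Fin n) ℝ} (hR : R.PosDef)
    (x : Fin n → ℝ) :
    ‖WithLp.toLp 2 (R *ᵥ x)‖ ^ 2 ≤ specNorm R * (x ⬝ᵥ (R *ᵥ x)) := by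
  obtain ⟨C, -, rfl⟩ := hR.exists_isUnit_transpose_mul_self
  have h1 := norm_toLp_mulVec_le Cᵀ (C *ᵥ x)
  rw [specNorm_transpose] at h1
  rw [specNorm_transpose_mul_self, ← mulVec_mulVec, dotProduct_mulVec, vecMul_transpose,
    dotProduct_self_eq_norm_sq]
  calc _ ≤ (specNorm C * ‖WithLp.toLp 2 (C *ᵥ x)‖) ^ 2 := by gcongr
    _ = _ := by ring

end SpectralNorm

theorem sq_mul_norm_le_of_posSemidef {d p : ℕ} {R : Matrix (Fin p) (Fin p) ℝ} (hR : R.PosDef)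
    {B : Matrix (Fin d) (Fin p) ℝ} {σ : ℝ}
    (hB : (B * Bᵀ - σ ^ 2 • (1 : Matrix (Fin d) (Fin d) ℝ)).PosSemidef) (x : Fin d → ℝ) :
    σ ^ 2 * ‖WithLp.toLp 2 x‖ ≤
      specNorm R * ‖WithLp.toLp 2 ((B * R⁻¹ * Bᵀ) *ᵥ x)‖ := by
  have hdet := (isUnit_iff_isUnit_det R).mp hR.isUnit
  have h1 : σ ^ 2 * ‖WithLp.toLp 2 x‖ ^ 2 ≤ ‖WithLp.toLp 2 (Bᵀ *ᵥ x)‖ ^ 2 := by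
    have h := hB.dotProduct_mulVec_nonneg x
    rw [star_trivial, sub_mulVec, dotProduct_sub, ← mulVec_mulVec, dotProduct_mulVec,
      ← mulVec_transpose, smul_mulVec, one_mulVec, dotProduct_smul, smul_eq_mul,
      dotProduct_self_eq_norm_sq, dotProduct_self_eq_norm_sq] at h
    linarith
  have h2 := norm_mulVec_sq_le_of_posDef hR (R⁻¹ *ᵥ (Bᵀ *ᵥ x))
  have h3 : R *ᵥ (R⁻¹ *ᵥ (Bᵀ *ᵥ x)) = Bᵀ *ᵥ x := by
    rw [mulVec_mulVec, mul_nonsing_inv R hdet, one_mulVec]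
  have h4 : (R⁻¹ *ᵥ (Bᵀ *ᵥ x)) ⬝ᵥ (Bᵀ *ᵥ x) = x ⬝ᵥ ((B * R⁻¹ * Bᵀ) *ᵥ x) := by
    rw [dotProduct_comm, ← mulVec_mulVec, ← mulVec_mulVec, dotProduct_mulVec x B,
      mulVec_transpose B x]
  rw [h3, h4] at h2
  have h5 := mul_le_mul_of_nonneg_left
    (dotProduct_le_norm_mul_norm x ((B * R⁻¹ * Bᵀ) *ᵥ x)) (specNorm_nonneg_s13 R)
  rcases (norm_nonneg (WithLp.toLp 2 x)).eq_or_lt with h0 | h0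
  · rw [← h0, mul_zero]
    exact mul_nonneg (specNorm_nonneg_s13 R) (norm_nonneg _)
  · refine le_of_mul_le_mul_right ?_ h0
    linarith

theorem trace_weighted_gram_eq {n p : ℕ} (C : Matrix (Fin p) (Fin p) ℝ)
    (F : Matrix (Fin n) (Fin n) ℝ) (E : Matrix (Fin p) (Fin n) ℝ) :
    ((Cᵀ * C) * (E * (Fᵀ * F) * Eᵀ)).trace = ((C * E * Fᵀ) * (C * E * Fᵀ)ᴴ).trace := by
  rw [Matrix.mul_assoc Cᵀ, trace_mul_comm Cᵀ, conjTranspose_eq_transpose_of_trivial]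
  simp only [transpose_mul, transpose_transpose, Matrix.mul_assoc]

theorem trace_weighted_gram_nonneg {n p : ℕ} {R : Matrix (Fin p) (Fin p) ℝ} (hR : R.PosDef)
    {S : Matrix (Fin n) (Fin n) ℝ} (hS : S.PosDef) (E : Matrix (Fin p) (Fin n) ℝ) :
    0 ≤ (R * (E * S * Eᵀ)).trace := by
  obtain ⟨C, -, rfl⟩ := hR.exists_isUnit_transpose_mul_self
  obtain ⟨F, -, rfl⟩ := hS.exists_isUnit_transpose_mul_self
  rw [trace_weighted_gram_eq]
  exact (posSemidef_self_mul_conjTranspose _).trace_nonneg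

theorem eq_zero_of_trace_weighted_gram_eq_zero {n p : ℕ} {R : Matrix (Fin p) (Fin p) ℝ}
    (hR : R.PosDef) {S : Matrix (Fin n) (Fin n) ℝ} (hS : S.PosDef)
    {E : Matrix (Fin p) (Fin n) ℝ} (h : (R * (E * S * Eᵀ)).trace = 0) : E = 0 := by
  obtain ⟨C, hC, rfl⟩ := hR.exists_isUnit_transpose_mul_self
  obtain ⟨F, hF, rfl⟩ := hS.exists_isUnit_transpose_mul_self
  rw [trace_weighted_gram_eq, trace_mul_conjTranspose_self_eq_zero_iff] at h
  have hC' := (isUnit_iff_isUnit_det C).mp hC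
  have hF' : IsUnit Fᵀ.det := by
    rw [det_transpose]
    exact (isUnit_iff_isUnit_det F).mp hF
  calc E = C⁻¹ * (C * E * Fᵀ) * Fᵀ⁻¹ := by
        rw [← Matrix.mul_assoc, nonsing_inv_mul_cancel_left _ _ hC',
          mul_nonsing_inv_cancel_right _ _ hF']
    _ = 0 := by rw [h, Matrix.mul_zero, Matrix.zero_mul]

/-- with `R ≻ 0`, `B Bᵀ ⪰ σ² I`, `‖B‖ ≤ β`, `‖A‖ ≤ a₀`, `‖M‖ ≤ m`,
the matrix `B R⁻¹ Bᵀ` is invertible, and `K₀ = R⁻¹ Bᵀ (B R⁻¹ Bᵀ)⁻¹ (M − A)` satisfies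
(i) `A + B K₀ = M`; (ii) for every `Σ ≻ 0`, `K₀` is the unique minimizer of
`K ↦ Tr(R K Σ Kᵀ)` over `{K : A + B K = M}`; (iii) `‖K₀‖ ≤ κ_R (β/σ²)(m + a₀)`,
where `κ_R = ‖R‖‖R⁻¹‖`. -/
theorem stmt13 {d p : ℕ}
    (R : Matrix (Fin p) (Fin p) ℝ) (hR : R.PosDef)
    (B : Matrix (Fin d) (Fin p) ℝ)
    (σ : ℝ) (hσ : 0 < σ)
    (hBB : (B * Bᵀ - σ ^ 2 • (1 : Matrix (Fin d) (Fin d) ℝ)).PosSemidef)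
    (β : ℝ) (hβ : specNorm B ≤ β)
    (A M : Matrix (Fin d) (Fin d) ℝ)
    (a₀ m : ℝ) (hA : specNorm A ≤ a₀) (hM : specNorm M ≤ m)
    (K₀ : Matrix (Fin p) (Fin d) ℝ)
    (hK₀ : K₀ = R⁻¹ * Bᵀ * (B * R⁻¹ * Bᵀ)⁻¹ * (M - A)) :
    IsUnit (B * R⁻¹ * Bᵀ) ∧
    A + B * K₀ = M ∧
    (∀ (Sig : Matrix (Fin d) (Fin d) ℝ), Sig.PosDef →
      ∀ K : Matrix (Fin p) (Fin d) ℝ, A + B * K = M →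
        (R * (K₀ * Sig * K₀ᵀ)).trace ≤ (R * (K * Sig * Kᵀ)).trace ∧
        ((R * (K * Sig * Kᵀ)).trace = (R * (K₀ * Sig * K₀ᵀ)).trace → K = K₀)) ∧
    specNorm K₀ ≤ (specNorm R * specNorm R⁻¹) * (β / σ ^ 2) * (m + a₀) := by
  have hRdet := (isUnit_iff_isUnit_det R).mp hR.isUnit
  have hRT : Rᵀ = R := by
    rw [← conjTranspose_eq_transpose_of_trivial]
    exact hR.isHermitian
  have hlow := sq_mul_norm_le_of_posSemidef hR hBB
  have hσ2 : 0 < σ ^ 2 := by positivity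
  set S := B * R⁻¹ * Bᵀ with hS
  have hSunit : IsUnit S := by
    rw [← mulVec_injective_iff_isUnit]
    refine (injective_iff_map_eq_zero S.mulVecLin).mpr fun x hx => ?_
    rw [mulVecLin_apply] at hx
    have h := hlow x
    rw [hx, WithLp.toLp_zero, norm_zero, mul_zero] at h
    have h0 : ‖WithLp.toLp 2 x‖ = 0 :=
      le_antisymm (nonpos_of_mul_nonpos_right h hσ2) (norm_nonneg _)
    simpa using h0
  have hSdet := (isUnit_iff_isUnit_det S).mp hSunit
  have hBK : B * K₀ = M - A := by
    rw [hK₀, ← Matrix.mul_assoc, ← Matrix.mul_assoc, ← Matrix.mul_assoc, ← hS,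
      mul_nonsing_inv S hSdet, Matrix.one_mul]
  have hRK : R * K₀ = Bᵀ * (S⁻¹ * (M - A)) := by
    rw [hK₀, Matrix.mul_assoc, Matrix.mul_assoc, mul_nonsing_inv_cancel_left _ _ hRdet]
  have hSinv : specNorm S⁻¹ ≤ specNorm R / σ ^ 2 := by
    refine specNorm_le_of_mulVec_le _ (div_nonneg (specNorm_nonneg_s13 R) hσ2.le) fun x => ?_
    have h := hlow (S⁻¹ *ᵥ x)
    rw [mulVec_mulVec, mul_nonsing_inv S hSdet, one_mulVec] at h
    rw [div_mul_eq_mul_div, le_div_iff₀ hσ2]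
    linarith
  refine ⟨hSunit, by rw [hBK]; abel, fun Sig hSig K hK => ?_, ?_⟩
  · obtain ⟨E, rfl⟩ : ∃ E, K = K₀ + E := ⟨K - K₀, by abel⟩
    have hBE : B * E = 0 := by
      rw [Matrix.mul_add, hBK] at hK
      rwa [← add_assoc, add_sub_cancel, add_eq_left] at hK
    have hERK : Eᵀ * (R * K₀) = 0 := by
      rw [hRK, ← Matrix.mul_assoc, ← transpose_mul, hBE, transpose_zero, Matrix.zero_mul]
    have hKRE : K₀ᵀ * (R * E) = 0 := by
      have h := congrArg transpose hERK
      rwa [transpose_mul, transpose_mul, transpose_transpose, hRT, transpose_zero,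
        Matrix.mul_assoc] at h
    have hc1 : (R * (K₀ * Sig * Eᵀ)).trace = 0 := by
      rw [← Matrix.mul_assoc, trace_mul_comm, ← Matrix.mul_assoc R, ← Matrix.mul_assoc, hERK,
        Matrix.zero_mul, trace_zero]
    have hc2 : (R * (E * Sig * K₀ᵀ)).trace = 0 := by
      rw [← Matrix.mul_assoc, trace_mul_comm, ← Matrix.mul_assoc R, ← Matrix.mul_assoc, hKRE,
        Matrix.zero_mul, trace_zero]
    have hexp : (R * ((K₀ + E) * Sig * (K₀ + E)ᵀ)).trace =
        (R * (K₀ * Sig * K₀ᵀ)).trace + (R * (E * Sig * Eᵀ)).trace := by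
      simp only [transpose_add, Matrix.add_mul, Matrix.mul_add, trace_add, hc1, hc2]
      ring
    rw [hexp]
    refine ⟨le_add_of_nonneg_right (trace_weighted_gram_nonneg hR hSig E), fun h => ?_⟩
    rw [eq_zero_of_trace_weighted_gram_eq_zero hR hSig (add_eq_left.mp h), add_zero]
  · have hβ0 : 0 ≤ β := (specNorm_nonneg_s13 B).trans hβ
    have hMA : specNorm (M - A) ≤ m + a₀ := (specNorm_sub_le M A).trans (add_le_add hM hA)
    have hR0 := specNorm_nonneg_s13 R
    have hRi0 := specNorm_nonneg_s13 R⁻¹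
    calc specNorm K₀
        ≤ specNorm R⁻¹ * specNorm Bᵀ * specNorm S⁻¹ * specNorm (M - A) := by
          rw [hK₀]
          refine (specNorm_mul_le _ _).trans
            (mul_le_mul_of_nonneg_right ?_ (specNorm_nonneg_s13 _))
          refine (specNorm_mul_le _ _).trans
            (mul_le_mul_of_nonneg_right (specNorm_mul_le _ _) (specNorm_nonneg_s13 _))
      _ ≤ specNorm R⁻¹ * β * (specNorm R / σ ^ 2) * (m + a₀) := by
          rw [specNorm_transpose]
          have := specNorm_nonneg_s13 S⁻¹
          have := specNorm_nonneg_s13 (M - A)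
          gcongr
      _ = _ := by ring
end
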